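/- Let q be a prime, let G be a subgroup of Perm (Fin q), and let ρ : G → ℤ/qℤ be a nontrivial group homomorphism into the additive group of integers modulo q. Suppose σ ∈ G is a primitive permutation (a q-cycle) with ρ(σ) ≠ 0. Then every element of G is a power of σ: for every g ∈ G there is an integer k with g = σ^k. -/

import Mathlib

/-- Let `q` be prime, `G ≤ Perm (Fin q)`, and
`ρ : G → ℤ/qℤ` a nontrivial homomorphism (written into
`Multiplicative (ZMod q)`).  If `σ ∈ G` is a primitive permutation (a
`q`-cycle) with `ρ(σ) ≠ 0`, then every element of `G` is a power of `σ`. -/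
theorem all_powers_of_primitive_of_hom_to_zmod
    (q : ℕ) (hq : q.Prime)
    (G : Subgroup (Equiv.Perm (Fin q)))
    (ρ : G →* Multiplicative (ZMod q))
    (hnontriv : ∃ g : G, ρ g ≠ 1)
    (σ : Equiv.Perm (Fin q)) (hσ : σ ∈ G)
    (hprim : σ.IsCycle ∧ σ.support = Finset.univ)
    (hρσ : ρ ⟨σ, hσ⟩ ≠ 1) :
    ∀ g ∈ G, ∃ k : ℤ, g = σ ^ k := by
  classical
  haveI : Fact q.Prime := ⟨hq⟩
  obtain ⟨hc, hs⟩ := hprim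
  have hmem : ∀ x, σ x ≠ x := fun x => by
    have : x ∈ σ.support := hs ▸ Finset.mem_univ x
    simpa using this
  have hcard : Nat.card (Multiplicative (ZMod q)) = q := by simp
  haveI ht : MulAction.IsPretransitive G (Fin q) := ⟨fun x y => by
    obtain ⟨i, hi⟩ := hc.sameCycle (hmem x) (hmem y)
    exact ⟨⟨σ, hσ⟩ ^ i, by simpa [Subgroup.smul_def] using hi⟩⟩
  haveI : MulAction.IsPreprimitive G (Fin q) :=
    MulAction.IsPreprimitive.of_prime_card (by simpa using hq)
  have hgen : ∀ b : Multiplicative (ZMod q), b ∈ Subgroup.zpowers (ρ ⟨σ, hσ⟩) := fun b =>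
    mem_zpowers_of_prime_card hcard hρσ
  have hsurj : Function.Surjective ρ := fun b => by
    obtain ⟨k, hk⟩ := hgen b
    exact ⟨⟨σ, hσ⟩ ^ k, by simpa using hk⟩
  have hker : ρ.ker = ⊥ := by
    by_contra hne
    have hfix : MulAction.fixedPoints ρ.ker (Fin q) ≠ Set.univ := by
      intro h
      apply hne
      rw [eq_bot_iff]
      intro k hk
      rw [Subgroup.mem_bot]
      ext x
      have : x ∈ MulAction.fixedPoints ρ.ker (Fin q) := h ▸ Set.mem_univ x
      have := this ⟨k, hk⟩
      exact congrArg Fin.val this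
    have htr : MulAction.IsPretransitive ρ.ker (Fin q) :=
      MulAction.IsQuasiPreprimitive.isPretransitive_of_normal hfix
    have x : Fin q := ⟨0, hq.pos⟩
    have h1 : q ∣ Nat.card ρ.ker := by
      have := (MulAction.stabilizer ρ.ker x).index_dvd_card
      rwa [MulAction.index_stabilizer_of_transitive, Nat.card_fin] at this
    have h2 : Nat.card ρ.ker * q = Nat.card G := by
      rw [← ρ.ker.card_mul_index, Subgroup.index_ker, MonoidHom.range_eq_top.2 hsurj,
        Subgroup.card_top, hcard]
    have h3 : Nat.card G ∣ q.factorial := by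
      have := G.card_subgroup_dvd_card
      rwa [Nat.card_perm, Nat.card_fin] at this
    have h4 : q * q ∣ q * (q-1).factorial := by
      rw [Nat.mul_factorial_pred hq.ne_zero]
      exact (Nat.mul_dvd_mul_right h1 q).trans (h2 ▸ h3)
    have h5 := (hq.dvd_factorial).1 (Nat.dvd_of_mul_dvd_mul_left hq.pos h4)
    have := hq.pos
    omega
  intro g hg
  obtain ⟨k, hk⟩ := hgen (ρ ⟨g, hg⟩)
  refine ⟨k, ?_⟩
  have := (MonoidHom.ker_eq_bot_iff ρ).1 hker (a₁ := ⟨g, hg⟩) (a₂ := ⟨σ, hσ⟩ ^ k)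
    (by simpa using hk.symm)
  simpa using congrArg Subtype.val this
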